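/- Let H and U be separable complex Hilbert spaces, A : H → H and B : U → H bounded linear operators, and assume the semigroup generated by A* is uniformly bounded, i.e. sup_{t ≥ 0} ‖exp(tA*)‖ < ∞. Then the system [A,B] is exponentially stabilizable if and only if the pair (A*,B*) satisfies (HESI)_β for some β > 0. -/

import Mathlib

open MeasureTheory ContinuousLinearMap FourierTransform

section ExponentialOrbit

variable {H : Type*} [NormedAddCommGroup H] [NormedSpace ℂ H] [CompleteSpace H]

lemma hasDerivAt_exp_smul_apply (S : H →L[ℂ] H) (φ : H) (t : ℝ) :
    HasDerivAt (fun s : ℝ => NormedSpace.exp (s • S) φ) (S (NormedSpace.exp (t • S) φ)) t :=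
  ((ContinuousLinearMap.apply ℂ H φ).restrictScalars ℝ).hasFDerivAt.comp_hasDerivAt t
    (hasDerivAt_exp_smul_const' S t)

lemma exp_add_smul_apply (S : H →L[ℂ] H) (s t : ℝ) (φ : H) :
    NormedSpace.exp ((s + t) • S) φ = NormedSpace.exp (s • S) (NormedSpace.exp (t • S) φ) := by
  let _ : NormedAlgebra ℚ (H →L[ℂ] H) := NormedAlgebra.restrictScalars ℚ ℝ _
  rw [add_smul, NormedSpace.exp_add_of_commute (((Commute.refl S).smul_left s).smul_right t)]
  rfl

lemma contDiff_exp_smul (S : H →L[ℂ] H) (n : WithTop ℕ∞) :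
    ContDiff ℝ n (fun s : ℝ => NormedSpace.exp (s • S)) := by
  have h : ContDiff ℝ n (NormedSpace.exp : (H →L[ℂ] H) → (H →L[ℂ] H)) :=
    contDiff_iff_contDiffAt.2 fun x => (NormedSpace.exp_analytic (𝕂 := ℝ) x).contDiffAt
  exact h.comp (contDiff_id.smul contDiff_const)

lemma contDiff_exp_smul_apply (S : H →L[ℂ] H) (φ : H) (n : WithTop ℕ∞) :
    ContDiff ℝ n (fun s : ℝ => NormedSpace.exp (s • S) φ) :=
  ((ContinuousLinearMap.apply ℂ H φ).restrictScalars ℝ).contDiff.comp (contDiff_exp_smul S n)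

/-- An exponentially decaying semigroup satisfies the Hille-Yosida resolvent lower bound. -/
lemma norm_le_of_exp_decay (S : H →L[ℂ] H) {M α : ℝ}
    (hM : ∀ t : ℝ, 0 ≤ t → ‖NormedSpace.exp (t • S)‖ ≤ M * Real.exp (-α * t))
    {lam : ℂ} (hlam : -α < lam.re) (φ : H) :
    ‖φ‖ ≤ M / (lam.re + α) * ‖lam • φ - S φ‖ := by
  have hb : 0 < lam.re + α := by linarith
  set b := lam.re + α with hbdef
  set g := lam • φ - S φ with hg
  have hM0 : 0 ≤ M := by simpa using (norm_nonneg _).trans (hM 0 le_rfl)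
  let y : ℝ → H := fun t => Complex.exp (-lam * t) • NormedSpace.exp (t • S) φ
  have hy (t : ℝ) : HasDerivAt y (-(Complex.exp (-lam * t) • NormedSpace.exp (t • S) g)) t := by
    have h1 : HasDerivAt (fun t : ℝ => Complex.exp (-lam * t))
        (Complex.exp (-lam * t) * (-lam)) t := by
      have := ((hasDerivAt_id (t : ℂ)).const_mul (-lam)).cexp.comp_ofReal
      simpa using this
    have h2 := h1.smul (hasDerivAt_exp_smul_apply S φ t)
    refine h2.congr_deriv ?_
    have hcomm : S (NormedSpace.exp (t • S) φ) = NormedSpace.exp (t • S) (S φ) := by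
      let _ : NormedAlgebra ℚ (H →L[ℂ] H) := NormedAlgebra.restrictScalars ℚ ℝ _
      exact DFunLike.congr_fun ((Commute.refl S).smul_right t).exp_right.eq φ
    rw [hg, map_sub, map_smul, hcomm]
    module
  have hnexp (t : ℝ) : ‖Complex.exp (-lam * t)‖ = Real.exp (-lam.re * t) := by
    rw [Complex.norm_exp]; simp
  have hnorm (t : ℝ) (ht : 0 ≤ t) (x : H) :
      ‖Complex.exp (-lam * t) • NormedSpace.exp (t • S) x‖ ≤ M * Real.exp (-b * t) * ‖x‖ := by
    rw [norm_smul, hnexp]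
    have h1 := (NormedSpace.exp (t • S)).le_of_opNorm_le (hM t ht) x
    calc _ ≤ Real.exp (-lam.re * t) * (M * Real.exp (-α * t) * ‖x‖) := by gcongr
      _ = M * (Real.exp (-lam.re * t) * Real.exp (-α * t)) * ‖x‖ := by ring
      _ = _ := by rw [← Real.exp_add]; congr 3; rw [hbdef]; ring
  have key (T : ℝ) (hT : 0 ≤ T) :
      ‖φ‖ ≤ M * Real.exp (-b * T) * ‖φ‖ + M / b * ‖g‖ := by
    have h0 : y 0 = φ := by simp [y]
    have hB (x : ℝ) : HasDerivAt (fun t => M / b * ‖g‖ * (1 - Real.exp (-b * t)))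
        (M * Real.exp (-b * x) * ‖g‖) x := by
      have h1 : HasDerivAt (fun t : ℝ => Real.exp (-b * t)) (Real.exp (-b * x) * (-b)) x := by
        simpa using ((hasDerivAt_id x).const_mul (-b)).exp
      refine ((h1.const_sub 1).const_mul (M / b * ‖g‖)).congr_deriv ?_
      have := hb.ne'
      field_simp
    have h2 := image_norm_le_of_norm_deriv_right_le_deriv_boundary
      (f := fun t => y t - y 0) (a := 0) (b := T)
      (f' := fun t => -(Complex.exp (-lam * t) • NormedSpace.exp (t • S) g))
      (fun t _ => ((hy t).sub_const _).continuousAt.continuousWithinAt)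
      (fun t _ => ((hy t).sub_const _).hasDerivWithinAt)
      (by simp) hB
      (fun t ht => by rw [norm_neg]; exact hnorm t ht.1 g) (Set.right_mem_Icc.2 hT)
    have h3 : ‖φ‖ ≤ ‖y T‖ + ‖y T - y 0‖ := by
      rw [h0, norm_sub_rev]; simpa using norm_add_le (y T) (φ - y T)
    have h4 := hnorm T hT φ
    have h5 : M / b * ‖g‖ * (1 - Real.exp (-b * T)) ≤ M / b * ‖g‖ := by
      have := Real.exp_pos (-b * T)
      have : 0 ≤ M / b * ‖g‖ := by positivity
      nlinarith
    linarith
  have hlim : Filter.Tendsto (fun T : ℝ => M * Real.exp (-b * T) * ‖φ‖ + M / b * ‖g‖)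
      Filter.atTop (nhds (M * 0 * ‖φ‖ + M / b * ‖g‖)) := by
    refine ((Filter.Tendsto.const_mul M ?_).mul_const _).add_const _
    exact Real.tendsto_exp_atBot.comp
      (Filter.tendsto_id.const_mul_atTop_of_neg (by linarith))
  have := ge_of_tendsto hlim ((Filter.eventually_ge_atTop 0).mono key)
  simpa using this

end ExponentialOrbit

section InnerProduct

variable {H U : Type*} [NormedAddCommGroup H] [InnerProductSpace ℂ H] [CompleteSpace H]
  [NormedAddCommGroup U] [InnerProductSpace ℂ U] [CompleteSpace U]

lemma integral_norm_sq_fourier_of_hasCompactSupport {g : ℝ → H}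
    (hg : HasCompactSupport g) (hg' : ContDiff ℝ (⊤ : ℕ∞) g) :
    ∫ ξ, ‖𝓕 g ξ‖ ^ 2 = ∫ t, ‖g t‖ ^ 2 := by
  have := SchwartzMap.integral_norm_sq_fourier (hg.toSchwartzMap hg')
  simpa [SchwartzMap.fourier_coe] using! this

lemma integrable_norm_sq_fourier_of_hasCompactSupport {V : Type*} [NormedAddCommGroup V] [InnerProductSpace ℂ V]
    {g : ℝ → V}
    (hg : HasCompactSupport g) (hg' : ContDiff ℝ (⊤ : ℕ∞) g) :
    Integrable (fun ξ => ‖𝓕 g ξ‖ ^ 2) := by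
  have := ((𝓕 (hg.toSchwartzMap hg')).memLp 2 volume).integrable_norm_pow (by norm_num)
  simpa [SchwartzMap.fourier_coe] using! this

lemma fourier_clm_comp (L : H →L[ℂ] U) {f : ℝ → H} (hf : Integrable f) (ξ : ℝ) :
    𝓕 (fun t => L (f t)) ξ = L (𝓕 f ξ) := by
  rw [Real.fourier_eq, Real.fourier_eq,
    ← L.integral_comp_comm ((Real.fourierIntegral_convergent_iff ξ).2 hf)]
  simp [Circle.smul_def]

/-- By Plancherel, a Hautus inequality on the imaginary axis gives an observation inequality
for compactly supported trajectories with a source term. -/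
lemma integral_norm_sq_le_of_hautus (S : H →L[ℂ] H) (G : H →L[ℂ] U) {c : ℝ}
    (h : ∀ ξ : ℝ, ∀ φ : H,
      ‖φ‖ ^ 2 ≤ c * (‖(2 * Real.pi * Complex.I * ξ : ℂ) • φ - S φ‖ ^ 2 + ‖G φ‖ ^ 2))
    {f : ℝ → H} (hs : HasCompactSupport f) (hf : ContDiff ℝ (⊤ : ℕ∞) f) :
    ∫ t, ‖f t‖ ^ 2 ≤ c * ((∫ t, ‖deriv f t - S (f t)‖ ^ 2) + ∫ t, ‖G (f t)‖ ^ 2) := by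
  have hSs : HasCompactSupport (fun t => S (f t)) := hs.comp_left (g := S) (map_zero S)
  have hGs : HasCompactSupport (fun t => G (f t)) := hs.comp_left (g := G) (map_zero G)
  have hSf : ContDiff ℝ (⊤ : ℕ∞) (fun t => S (f t)) := (S.restrictScalars ℝ).contDiff.comp hf
  have hGf : ContDiff ℝ (⊤ : ℕ∞) (fun t => G (f t)) := (G.restrictScalars ℝ).contDiff.comp hf
  have hd : ContDiff ℝ (⊤ : ℕ∞) (deriv f) := (contDiff_infty_iff_deriv.1 hf).2
  have hrs : HasCompactSupport (fun t => deriv f t - S (f t)) := hs.deriv.sub hSs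
  have hrf : ContDiff ℝ (⊤ : ℕ∞) (fun t => deriv f t - S (f t)) := hd.sub hSf
  have hfi : Integrable f := hf.continuous.integrable_of_hasCompactSupport hs
  have hres (ξ : ℝ) : 𝓕 (fun t => deriv f t - S (f t)) ξ
      = (2 * Real.pi * Complex.I * ξ : ℂ) • 𝓕 f ξ - S (𝓕 f ξ) := by
    rw [← fourier_clm_comp S hfi, ← congrFun (Real.fourier_deriv hfi (hf.differentiable (by simp))
      (hd.continuous.integrable_of_hasCompactSupport hs.deriv)) ξ]
    simp only [Real.fourier_eq, smul_sub]
    exact integral_sub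
      ((Real.fourierIntegral_convergent_iff ξ).2
        (hd.continuous.integrable_of_hasCompactSupport hs.deriv))
      ((Real.fourierIntegral_convergent_iff ξ).2
        (hSf.continuous.integrable_of_hasCompactSupport hSs))
  have hif := integrable_norm_sq_fourier_of_hasCompactSupport hs hf
  have hir := integrable_norm_sq_fourier_of_hasCompactSupport hrs hrf
  have hiG := integrable_norm_sq_fourier_of_hasCompactSupport hGs hGf
  rw [← integral_norm_sq_fourier_of_hasCompactSupport hs hf,
    ← integral_norm_sq_fourier_of_hasCompactSupport hrs hrf,
    ← integral_norm_sq_fourier_of_hasCompactSupport hGs hGf,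
    ← integral_add hir hiG, ← integral_const_mul]
  refine integral_mono hif ((hir.add hiG).const_mul c) fun ξ => ?_
  simp only [hres, fourier_clm_comp G hfi]
  exact h ξ _

lemma exists_smooth_cutoff : ∃ χ : ℝ → ℝ, ∃ D : ℝ, ContDiff ℝ (⊤ : ℕ∞) χ ∧
    (∀ x, ‖deriv χ x‖ ≤ D) ∧ (∀ x, 0 ≤ χ x) ∧ (∀ x, χ x ≤ 1) ∧ (∀ x, |x| ≤ 1 → χ x = 1) ∧
    (∀ x, 2 < |x| → χ x = 0) ∧ ∀ x, 2 < |x| → deriv χ x = 0 := by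
  let χ : ContDiffBump (0 : ℝ) := ⟨1, 2, one_pos, one_lt_two⟩
  have hχ : ContDiff ℝ (⊤ : ℕ∞) χ := χ.contDiff
  obtain ⟨D, hD⟩ : ∃ D, ∀ x, ‖deriv χ x‖ ≤ D :=
    χ.hasCompactSupport.deriv.exists_bound_of_continuous (hχ.continuous_deriv (by simp))
  refine ⟨χ, D, hχ, hD, fun _ => χ.nonneg, fun _ => χ.le_one,
    fun x hx => χ.one_of_mem_closedBall (by simpa [χ] using hx),
    fun x hx => χ.zero_of_le_dist (by simpa [χ] using hx.le), fun x hx => ?_⟩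
  have : x ∉ tsupport χ := by
    rw [χ.tsupport_eq]; simpa [χ] using hx
  exact image_eq_zero_of_notMem_tsupport fun h' => this (tsupport_deriv_subset h')

/-- A bounded semigroup with a Hautus inequality on the imaginary axis is weakly observable. -/
lemma exists_weak_observability (S : H →L[ℂ] H) (G : H →L[ℂ] U) {c M : ℝ} (hc : 0 ≤ c)
    (hM : ∀ t : ℝ, 0 ≤ t → ‖NormedSpace.exp (t • S)‖ ≤ M)
    (h : ∀ ξ : ℝ, ∀ φ : H,
      ‖φ‖ ^ 2 ≤ c * (‖(2 * Real.pi * Complex.I * ξ : ℂ) • φ - S φ‖ ^ 2 + ‖G φ‖ ^ 2)) :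
    ∃ τ : ℝ, 0 < τ ∧ ∃ γ : ℝ, γ < 1 ∧ ∃ k : ℝ, 0 ≤ k ∧ ∀ φ : H,
      ‖NormedSpace.exp (τ • S) φ‖ ^ 2 ≤
        γ * ‖φ‖ ^ 2 + k * ∫ t in 0..τ, ‖G (NormedSpace.exp (t • S) φ)‖ ^ 2 := by
  obtain ⟨χ, D, hχ, hD, hχnonneg, hχle, hχ1, hχ0, hdχ0⟩ := exists_smooth_cutoff
  have hM0 : 0 ≤ M := (norm_nonneg _).trans (hM 0 le_rfl)
  have hD0 : 0 ≤ D := (norm_nonneg _).trans (hD 0)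
  set X := 2 * c * D ^ 2 * M ^ 4 with hX
  have hX0 : 0 ≤ X := by positivity
  set r := X + 1 with hr
  have hr0 : 0 < r := by positivity
  refine ⟨4 * r, by positivity, X / r ^ 2, ?_, c * M ^ 2 / (2 * r), by positivity, fun φ => ?_⟩
  · rw [div_lt_one (by positivity)]; nlinarith
  let y : ℝ → H := fun t => NormedSpace.exp ((t + 2 * r) • S) φ
  let f : ℝ → H := fun t => χ (t / r) • y t
  have hyd (t : ℝ) : HasDerivAt y (S (y t)) t :=
    (hasDerivAt_exp_smul_apply S φ (t + 2 * r)).comp_add_const t (2 * r)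
  have hyc : ContDiff ℝ (⊤ : ℕ∞) y :=
    (contDiff_exp_smul_apply S φ _).comp (contDiff_id.add contDiff_const)
  have hχr : ContDiff ℝ (⊤ : ℕ∞) (fun t => χ (t / r)) := hχ.comp (contDiff_id.div_const r)
  have hfc : ContDiff ℝ (⊤ : ℕ∞) f := hχr.smul hyc
  have habs (t : ℝ) (ht : t ∉ Set.Icc (-(2 * r)) (2 * r)) : 2 < |t / r| := by
    rw [abs_div, abs_of_pos hr0, lt_div_iff₀ hr0]
    by_contra! h'
    exact ht (abs_le.1 h')
  have hfs : HasCompactSupport f :=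
    HasCompactSupport.intro (isCompact_Icc (a := -(2 * r)) (b := 2 * r)) fun t ht => by
      simp [f, hχ0 _ (habs t ht)]
  have hfd (t : ℝ) : deriv f t - S (f t) = (deriv χ (t / r) / r) • y t := by
    have h1 : HasDerivAt (fun t => χ (t / r)) (deriv χ (t / r) * (1 / r)) t :=
      (hχ.differentiable (by simp) (t / r)).hasDerivAt.comp t ((hasDerivAt_id t).div_const r)
    rw [show deriv f t = _ from (h1.smul (hyd t)).deriv]
    simp only [f, map_smul_of_tower]
    rw [mul_one_div]
    abel
  have hmain := integral_norm_sq_le_of_hautus S G h hfs hfc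
  have hloc (g : ℝ → ℝ) (hg : ∀ t, t ∉ Set.Icc (-(2 * r)) (2 * r) → g t = 0) :
      ∫ t, g t = ∫ t in (-(2 * r))..(2 * r), g t := by
    rw [intervalIntegral.integral_of_le (by linarith), ← integral_Icc_eq_integral_Ioc,
      setIntegral_eq_integral_of_forall_compl_eq_zero hg]
  have hyM (t : ℝ) (ht : -(2 * r) ≤ t) : ‖y t‖ ≤ M * ‖φ‖ :=
    ContinuousLinearMap.le_of_opNorm_le _ (hM _ (by linarith)) _
  have hyend (t : ℝ) (ht : t ≤ 2 * r) :
      ‖NormedSpace.exp ((4 * r) • S) φ‖ ≤ M * ‖y t‖ := by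
    rw [show 4 * r = (2 * r - t) + (t + 2 * r) by ring, exp_add_smul_apply]
    exact ContinuousLinearMap.le_of_opNorm_le _ (hM _ (by linarith)) _
  have hsource : ∫ t, ‖deriv f t - S (f t)‖ ^ 2 ≤ 4 * r * (D / r * (M * ‖φ‖)) ^ 2 := by
    rw [hloc _ fun t ht => by simp [hfd, hdχ0 _ (habs t ht)]]
    have := intervalIntegral.integral_mono_on (a := -(2 * r)) (b := 2 * r)
      (f := fun t => ‖deriv f t - S (f t)‖ ^ 2) (g := fun _ => (D / r * (M * ‖φ‖)) ^ 2)
      (μ := volume) (by linarith)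
      (((hfc.continuous_deriv (by simp)).sub
        (S.continuous.comp hfc.continuous)).norm.pow 2 |>.intervalIntegrable _ _)
      intervalIntegrable_const fun t ht => by
        rw [hfd, norm_smul, norm_div, Real.norm_of_nonneg hr0.le]
        gcongr
        · exact hD _
        · exact hyM t ht.1
    refine this.trans_eq ?_
    rw [intervalIntegral.integral_const, smul_eq_mul]
    ring
  have hobs : ∫ t, ‖G (f t)‖ ^ 2 ≤
      ∫ t in 0..(4 * r), ‖G (NormedSpace.exp (t • S) φ)‖ ^ 2 := by
    rw [hloc _ fun t ht => by simp [f, hχ0 _ (habs t ht)]]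
    have h1 : ∫ t in (-(2 * r))..(2 * r), ‖G (y t)‖ ^ 2 =
        ∫ t in 0..(4 * r), ‖G (NormedSpace.exp (t • S) φ)‖ ^ 2 := by
      have := intervalIntegral.integral_comp_add_right (a := -(2 * r)) (b := 2 * r)
        (fun t => ‖G (NormedSpace.exp (t • S) φ)‖ ^ 2) (2 * r)
      convert this using 2 <;> ring
    rw [← h1]
    refine intervalIntegral.integral_mono_on (by linarith)
      ((G.continuous.comp hfc.continuous).norm.pow 2 |>.intervalIntegrable _ _)
      ((G.continuous.comp hyc.continuous).norm.pow 2 |>.intervalIntegrable _ _) fun t _ => ?_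
    simp only [f, map_smul_of_tower, norm_smul, Real.norm_of_nonneg (hχnonneg _)]
    have := hχnonneg (t / r)
    gcongr
    exact mul_le_of_le_one_left (norm_nonneg _) (hχle _)
  have hlower : 2 * r * ‖NormedSpace.exp ((4 * r) • S) φ‖ ^ 2 ≤ M ^ 2 * ∫ t, ‖f t‖ ^ 2 := by
    have hs2 : HasCompactSupport (fun t => ‖f t‖ ^ 2) :=
      hfs.comp_left (g := fun x : H => ‖x‖ ^ 2) (by simp)
    have hint : Integrable (fun t => ‖f t‖ ^ 2) :=
      (hfc.continuous.norm.pow 2).integrable_of_hasCompactSupport hs2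
    have h1 : ∫ t in (-r)..r, ‖f t‖ ^ 2 ≤ ∫ t, ‖f t‖ ^ 2 := by
      rw [intervalIntegral.integral_of_le (by linarith)]
      exact setIntegral_le_integral hint (Filter.Eventually.of_forall fun _ => by positivity)
    have h2 := intervalIntegral.integral_mono_on (a := -r) (b := r)
      (f := fun _ => ‖NormedSpace.exp ((4 * r) • S) φ‖ ^ 2) (g := fun t => M ^ 2 * ‖f t‖ ^ 2)
      (μ := volume) (by linarith) intervalIntegrable_const
      (((hfc.continuous.norm.pow 2).const_mul _).intervalIntegrable _ _) fun t ht => by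
        have h3 : χ (t / r) = 1 := hχ1 _ (by
          rw [abs_div, abs_of_pos hr0]
          exact (div_le_one hr0).2 (abs_le.2 ht))
        simp only [f, h3, one_smul]
        rw [← mul_pow]
        gcongr
        exact hyend t (by linarith [ht.2])
    rw [intervalIntegral.integral_const, smul_eq_mul, intervalIntegral.integral_const_mul] at h2
    calc _ = (r - -r) * ‖NormedSpace.exp ((4 * r) • S) φ‖ ^ 2 := by ring
      _ ≤ _ := h2
      _ ≤ _ := by gcongr
  set I := ∫ t in 0..(4 * r), ‖G (NormedSpace.exp (t • S) φ)‖ ^ 2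
  have hfin : 2 * r * ‖NormedSpace.exp ((4 * r) • S) φ‖ ^ 2 ≤
      M ^ 2 * (c * (4 * r * (D / r * (M * ‖φ‖)) ^ 2 + I)) :=
    hlower.trans (by gcongr; exact hmain.trans (by gcongr))
  have heq : M ^ 2 * (c * (4 * r * (D / r * (M * ‖φ‖)) ^ 2 + I)) =
      2 * r * (X / r ^ 2 * ‖φ‖ ^ 2 + c * M ^ 2 / (2 * r) * I) := by
    rw [hX]
    have := hr0.ne'
    field_simp
    ring
  rw [heq] at hfin
  exact le_of_mul_le_mul_left hfin (by positivity)

lemma hasDerivAt_norm_sq_complex {V : Type*} [NormedAddCommGroup V] [InnerProductSpace ℂ V]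
    {f : ℝ → V} {f' : V} {t : ℝ} (hf : HasDerivAt f f' t) :
    HasDerivAt (fun s => ‖f s‖ ^ 2) (2 * (inner ℂ f' (f t)).re) t := by
  let _ : InnerProductSpace ℝ V := InnerProductSpace.rclikeToReal ℂ V
  refine hf.norm_sq.congr_deriv ?_
  rw [real_inner_comm]
  rfl

/-- Weak observability of a bounded semigroup generated by a bounded operator yields a coercive
quadratic form whose derivative along trajectories is dominated by the output. -/
lemma exists_lyapunov_of_weak_observability (S : H →L[ℂ] H) (G : H →L[ℂ] U) {M τ γ k : ℝ}
    (hM0 : 0 < M) (hτ : 0 < τ) (hγ : γ < 1) (hk : 0 ≤ k)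
    (hM : ∀ t : ℝ, 0 ≤ t → ‖NormedSpace.exp (t • S)‖ ≤ M)
    (hobs : ∀ φ : H, ‖NormedSpace.exp (τ • S) φ‖ ^ 2 ≤
      γ * ‖φ‖ ^ 2 + k * ∫ t in 0..τ, ‖G (NormedSpace.exp (t • S) φ)‖ ^ 2) :
    ∃ P : H →L[ℂ] H, IsSelfAdjoint P ∧
      (∀ φ : H, τ / M ^ 2 * ‖φ‖ ^ 2 ≤ (inner ℂ φ (P φ)).re) ∧
      ∀ φ : H, 2 * (inner ℂ (S φ) (P φ)).re ≤
        k * τ * ‖G φ‖ ^ 2 - (1 - γ) / M ^ 2 * ‖φ‖ ^ 2 := by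
  let E : ℝ → (H →L[ℂ] H) := fun t => NormedSpace.exp ((-t) • S)
  have hE : Continuous E := (contDiff_exp_smul S 0).continuous.comp continuous_neg
  let N : H →L[ℂ] H := adjoint G ∘L G
  let h : ℝ → (H →L[ℂ] H) := fun t => star (E t) * (1 + (k * (τ - t)) • N) * E t
  have hh : Continuous h := by
    refine (hE.star.mul (continuous_const.add ?_)).mul hE
    exact (continuous_const.mul (continuous_const.sub continuous_id)).smul continuous_const
  have hhi : IntervalIntegrable h volume 0 τ := hh.intervalIntegrable _ _
  have hinner (φ ψ : H) (t : ℝ) : (inner ℂ φ (h t ψ)).re =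
      (inner ℂ (E t φ) (E t ψ)).re + k * (τ - t) * (inner ℂ (G (E t φ)) (G (E t ψ))).re := by
    have h1 : h t ψ = adjoint (E t) (E t ψ + (k * (τ - t)) • adjoint G (G (E t ψ))) := rfl
    rw [h1, adjoint_inner_right, inner_add_right, inner_smul_right_eq_smul, adjoint_inner_right,
      Complex.add_re, Complex.real_smul, Complex.re_ofReal_mul]
  let P : H →L[ℂ] H := ∫ t in 0..τ, h t
  have hP (φ ψ : H) : (inner ℂ φ (P ψ)).re = ∫ t in 0..τ, (inner ℂ φ (h t ψ)).re := by
    let L : (H →L[ℂ] H) →L[ℝ] ℝ := Complex.reCLM ∘L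
      ((innerSL ℂ φ ∘L ContinuousLinearMap.apply ℂ H ψ).restrictScalars ℝ)
    exact (L.intervalIntegral_comp_comm hhi).symm
  have hdE (φ : H) (t : ℝ) : HasDerivAt (fun s => E s φ) (-(E t (S φ))) t := by
    have h1 := (hasDerivAt_exp_smul_apply S φ (-t)).scomp t (hasDerivAt_neg t)
    refine h1.congr_deriv ?_
    let _ : NormedAlgebra ℚ (H →L[ℂ] H) := NormedAlgebra.restrictScalars ℚ ℝ _
    have h2 : S (E t φ) = E t (S φ) :=
      DFunLike.congr_fun ((Commute.refl S).smul_right (-t)).exp_right.eq φ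
    rw [neg_one_smul]
    exact congrArg _ h2
  have hinv (φ : H) (t : ℝ) : NormedSpace.exp (t • S) (E t φ) = φ := by
    rw [← exp_add_smul_apply]; simp
  have hlow (φ : H) (t : ℝ) (ht : 0 ≤ t) : ‖φ‖ ^ 2 / M ^ 2 ≤ ‖E t φ‖ ^ 2 := by
    rw [← div_pow]
    gcongr
    rw [div_le_iff₀' hM0]
    conv_lhs => rw [← hinv φ t]
    exact ContinuousLinearMap.le_of_opNorm_le _ (hM t ht) _
  refine ⟨P, ?_, fun φ => ?_, fun φ => ?_⟩
  · have h1 := (starL' ℝ (A := H →L[ℂ] H)).toContinuousLinearMap.intervalIntegral_comp_comm hhi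
    refine h1.symm.trans (intervalIntegral.integral_congr fun t _ => ?_)
    have hN : star N = N := by
      change adjoint (adjoint G ∘L G) = _
      rw [adjoint_comp, adjoint_adjoint]
    change star (h t) = h t
    simp only [h, star_mul, star_add, star_one, star_smul, star_star, hN, mul_assoc, star_trivial]
  · rw [hP]
    have h1 := intervalIntegral.integral_mono_on (a := 0) (b := τ) (μ := volume)
      (f := fun _ => ‖φ‖ ^ 2 / M ^ 2) (g := fun t => (inner ℂ φ (h t φ)).re) hτ.le
      intervalIntegrable_const
      ((Complex.continuous_re.comp (continuous_const.inner
        (hh.clm_apply continuous_const))).intervalIntegrable _ _) fun t ht => by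
        rw [hinner, inner_self_eq_norm_sq_to_K, inner_self_eq_norm_sq_to_K]
        norm_cast
        have h2 := hlow φ t ht.1
        have h3 : 0 ≤ k * (τ - t) * ‖G (E t φ)‖ ^ 2 :=
          mul_nonneg (mul_nonneg hk (by linarith [ht.2])) (by positivity)
        exact h2.trans (le_add_of_nonneg_right h3)
    rw [intervalIntegral.integral_const, smul_eq_mul] at h1
    refine le_trans (le_of_eq ?_) h1
    ring
  · have hEc (ψ : H) : Continuous fun t => E t ψ := hE.clm_apply continuous_const
    let F : ℝ → ℝ := fun t => ‖E t φ‖ ^ 2 + k * (τ - t) * ‖G (E t φ)‖ ^ 2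
    have hF (t : ℝ) : HasDerivAt F
        (-(2 * (inner ℂ (S φ) (h t φ)).re) - k * ‖G (E t φ)‖ ^ 2) t := by
      have h1 := hasDerivAt_norm_sq_complex (hdE φ t)
      have h2 := hasDerivAt_norm_sq_complex
        ((G.restrictScalars ℝ).hasFDerivAt.comp_hasDerivAt t (hdE φ t))
      have h3 := ((hasDerivAt_id t).const_sub τ).const_mul k
      refine (h1.add (h3.mul h2)).congr_deriv ?_
      rw [hinner]
      simp only [Function.comp_apply, coe_restrictScalars', map_neg, inner_neg_left,
        Complex.neg_re, id_eq]
      ring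
    have hFTC := intervalIntegral.integral_eq_sub_of_hasDerivAt (a := 0) (b := τ)
      (fun t _ => hF t) (by
        refine Continuous.intervalIntegrable ?_ _ _
        exact ((continuous_const.mul (Complex.continuous_re.comp (continuous_const.inner
          (hh.clm_apply continuous_const)))).neg).sub
          (continuous_const.mul ((G.continuous.comp (hEc φ)).norm.pow 2)))
    rw [intervalIntegral.integral_sub, intervalIntegral.integral_neg,
      intervalIntegral.integral_const_mul, intervalIntegral.integral_const_mul, ← hP] at hFTC
    · have hE0 : E 0 φ = φ := by simp [E]
      have hI : ∫ t in 0..τ, ‖G (E t φ)‖ ^ 2 =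
          ∫ t in 0..τ, ‖G (NormedSpace.exp (t • S) (E τ φ))‖ ^ 2 := by
        have h1 := intervalIntegral.integral_comp_sub_left (a := 0) (b := τ)
          (fun t => ‖G (E t φ)‖ ^ 2) τ
        simp only [sub_self, sub_zero] at h1
        rw [← h1]
        refine intervalIntegral.integral_congr fun t _ => ?_
        simp only [E]
        rw [← exp_add_smul_apply]
        congr 6
        ring
      have h1 := hobs (E τ φ)
      rw [hinv, ← hI] at h1
      have h2 := hlow φ τ hτ.le
      simp only [F, hE0, sub_self, sub_zero, mul_zero, zero_mul, add_zero] at hFTC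
      have h3 : (1 - γ) / M ^ 2 * ‖φ‖ ^ 2 ≤ (1 - γ) * ‖E τ φ‖ ^ 2 := by
        rw [div_mul_eq_mul_div, mul_div_assoc]
        exact mul_le_mul_of_nonneg_left h2 (by linarith)
      linarith
    · exact ((continuous_const.mul (Complex.continuous_re.comp (continuous_const.inner
          (hh.clm_apply continuous_const)))).neg).intervalIntegrable _ _
    · exact (continuous_const.mul
        ((G.continuous.comp (hEc φ)).norm.pow 2)).intervalIntegrable _ _

/-- A coercive Lyapunov form with strict decrease gives exponential decay. -/
lemma exp_decay_of_lyapunov (S P : H →L[ℂ] H) (hP : IsSelfAdjoint P) {δ ε : ℝ}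
    (hδ : 0 < δ) (hε : 0 < ε) (hlow : ∀ φ : H, δ * ‖φ‖ ^ 2 ≤ (inner ℂ φ (P φ)).re)
    (hdec : ∀ φ : H, 2 * (inner ℂ (S φ) (P φ)).re ≤ -ε * ‖φ‖ ^ 2) :
    ∃ M : ℝ, 0 < M ∧ ∃ α : ℝ, 0 < α ∧
      ∀ t : ℝ, 0 ≤ t → ‖NormedSpace.exp (t • S)‖ ≤ M * Real.exp (-α * t) := by
  set p := ‖P‖ + 1 with hp
  have hp0 : 0 < p := by positivity
  have hup (φ : H) : (inner ℂ φ (P φ)).re ≤ p * ‖φ‖ ^ 2 := by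
    calc _ ≤ ‖inner ℂ φ (P φ)‖ := Complex.re_le_norm _
      _ ≤ ‖φ‖ * ‖P φ‖ := norm_inner_le_norm _ _
      _ ≤ ‖φ‖ * (‖P‖ * ‖φ‖) := by gcongr; exact P.le_opNorm φ
      _ ≤ _ := by rw [hp]; nlinarith [sq_nonneg ‖φ‖]
  refine ⟨√(p / δ), by positivity, ε / (2 * p), by positivity, fun t ht => ?_⟩
  refine ContinuousLinearMap.opNorm_le_bound _ (by positivity) fun φ => ?_
  let y : ℝ → H := fun t => NormedSpace.exp (t • S) φ
  let v : ℝ → ℝ := fun t => Real.exp (ε / p * t) * (inner ℂ (y t) (P (y t))).re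
  have hy (t : ℝ) : HasDerivAt y (S (y t)) t := hasDerivAt_exp_smul_apply S φ t
  have hv (t : ℝ) : HasDerivAt v (Real.exp (ε / p * t) *
      (ε / p * (inner ℂ (y t) (P (y t))).re + 2 * (inner ℂ (S (y t)) (P (y t))).re)) t := by
    have h1 : HasDerivAt (fun t => Real.exp (ε / p * t)) (Real.exp (ε / p * t) * (ε / p)) t := by
      simpa using ((hasDerivAt_id t).const_mul (ε / p)).exp
    have h2 := Complex.reCLM.hasFDerivAt.comp_hasDerivAt t ((hy t).inner ℂ
      ((P.restrictScalars ℝ).hasFDerivAt.comp_hasDerivAt t (hy t)))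
    refine (h1.mul h2).congr_deriv ?_
    have h3 : inner ℂ (y t) (P (S (y t))) = inner ℂ (P (y t)) (S (y t)) :=
      (hP.isSymmetric _ _).symm
    have h4 : (inner ℂ (P (y t)) (S (y t))).re = (inner ℂ (S (y t)) (P (y t))).re :=
      inner_re_symm (𝕜 := ℂ) _ _
    simp only [Function.comp_apply, coe_restrictScalars', Complex.reCLM_apply, Complex.add_re,
      h3, h4]
    ring
  have hanti : Antitone v := antitone_of_hasDerivAt_nonpos hv fun t => by
    refine mul_nonpos_of_nonneg_of_nonpos (Real.exp_pos _).le ?_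
    have h1 := mul_le_mul_of_nonneg_left (hup (y t)) (by positivity : 0 ≤ ε / p)
    have h2 := hdec (y t)
    rw [← mul_assoc, div_mul_cancel₀ _ hp0.ne'] at h1
    linarith
  have h1 : v t ≤ p * ‖φ‖ ^ 2 := (hanti ht).trans (by simpa [v, y] using hup φ)
  have h2 : δ * ‖y t‖ ^ 2 ≤ Real.exp (-(ε / p * t)) * (p * ‖φ‖ ^ 2) := by
    refine (hlow (y t)).trans ?_
    rw [Real.exp_neg, ← div_eq_inv_mul, le_div_iff₀' (Real.exp_pos _)]
    exact h1
  refine le_of_sq_le_sq ?_ (by positivity)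
  rw [mul_pow, mul_pow, Real.sq_sqrt (by positivity), ← Real.exp_nat_mul]
  calc ‖y t‖ ^ 2 ≤ Real.exp (-(ε / p * t)) * (p * ‖φ‖ ^ 2) / δ := (le_div_iff₀' hδ).2 h2
    _ = p / δ * Real.exp (-(ε / p * t)) * ‖φ‖ ^ 2 := by ring
    _ = _ := by congr 3; push_cast; field_simp

lemma norm_exp_smul_adjoint (S : H →L[ℂ] H) (t : ℝ) :
    ‖NormedSpace.exp (t • adjoint S)‖ = ‖NormedSpace.exp (t • S)‖ := by
  rw [← norm_star (NormedSpace.exp (t • S)), NormedSpace.star_exp, star_smul, star_trivial]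
  rfl

end InnerProduct

/-- If the semigroup generated by `A*` is uniformly bounded, then the system `[A,B]`
is exponentially stabilizable iff `(A*, B*)` satisfies (HESI)_β for some `β > 0`. -/
theorem stabilizable_iff_HESI_of_uniformlyBounded
    {H U : Type*}
    [NormedAddCommGroup H] [InnerProductSpace ℂ H] [CompleteSpace H]
    [TopologicalSpace.SeparableSpace H]
    [NormedAddCommGroup U] [InnerProductSpace ℂ U] [CompleteSpace U]
    [TopologicalSpace.SeparableSpace U]
    (A : H →L[ℂ] H) (B : U →L[ℂ] H)
    (hbdd : ∃ M : ℝ, ∀ t : ℝ, 0 ≤ t →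
      ‖NormedSpace.exp (t • ContinuousLinearMap.adjoint A)‖ ≤ M) :
    (∃ K : H →L[ℂ] U, ∃ M : ℝ, 0 < M ∧ ∃ α : ℝ, 0 < α ∧
      ∀ t : ℝ, 0 ≤ t →
        ‖NormedSpace.exp (t • (A + B ∘L K))‖ ≤ M * Real.exp (-α * t)) ↔
    (∃ β : ℝ, 0 < β ∧ ∃ C : ℝ, 0 < C ∧ ∀ lam : ℂ, -β < lam.re → ∀ φ : H,
      ‖φ‖ ^ 2 ≤ C / (lam.re + β) ^ 2 *
        (‖lam • φ - (ContinuousLinearMap.adjoint A) φ‖ ^ 2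
          + ‖(ContinuousLinearMap.adjoint B) φ‖ ^ 2)) := by
  have hadj (K : H →L[ℂ] U) (φ : H) :
      adjoint (A + B ∘L K) φ = adjoint A φ + adjoint K (adjoint B φ) := by
    rw [map_add, adjoint_comp]; rfl
  constructor
  · rintro ⟨K, M, hM, α, hα, hdecay⟩
    refine ⟨α, hα, 2 * M ^ 2 * (1 + ‖adjoint K‖ ^ 2), by positivity, fun lam hlam φ => ?_⟩
    have hb : 0 < lam.re + α := by linarith
    have h1 := norm_le_of_exp_decay (adjoint (A + B ∘L K))
      (fun t ht => (norm_exp_smul_adjoint _ t).trans_le (hdecay t ht)) hlam φ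
    rw [hadj, ← sub_sub] at h1
    set a := ‖lam • φ - adjoint A φ‖
    set b := ‖adjoint B φ‖
    have h2 : ‖lam • φ - adjoint A φ - adjoint K (adjoint B φ)‖ ≤ a + ‖adjoint K‖ * b :=
      (norm_sub_le _ _).trans (by gcongr; exact (adjoint K).le_opNorm _)
    have h3 : (a + ‖adjoint K‖ * b) ^ 2 ≤ 2 * (1 + ‖adjoint K‖ ^ 2) * (a ^ 2 + b ^ 2) := by
      nlinarith [sq_nonneg (a - ‖adjoint K‖ * b), sq_nonneg (‖adjoint K‖ * a), sq_nonneg b]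
    calc ‖φ‖ ^ 2 ≤ (M / (lam.re + α) * (a + ‖adjoint K‖ * b)) ^ 2 := by
          gcongr; exact h1.trans (by gcongr)
      _ = M ^ 2 / (lam.re + α) ^ 2 * (a + ‖adjoint K‖ * b) ^ 2 := by rw [mul_pow, div_pow]
      _ ≤ M ^ 2 / (lam.re + α) ^ 2 * (2 * (1 + ‖adjoint K‖ ^ 2) * (a ^ 2 + b ^ 2)) := by gcongr
      _ = _ := by ring
  · rintro ⟨β, hβ, C, hC, hH⟩
    obtain ⟨M₀, hM₀⟩ := hbdd
    set M := max M₀ 1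
    have hM0 : 0 < M := lt_max_of_lt_right one_pos
    have hM (t : ℝ) (ht : 0 ≤ t) : ‖NormedSpace.exp (t • adjoint A)‖ ≤ M :=
      (hM₀ t ht).trans (le_max_left _ _)
    obtain ⟨τ, hτ, γ, hγ, k, hk, hobs⟩ := exists_weak_observability (adjoint A) (adjoint B)
      (c := C / β ^ 2) (by positivity) hM fun ξ φ => by
        have hre : (2 * Real.pi * Complex.I * ξ : ℂ).re = 0 := by simp
        have h := hH (2 * Real.pi * Complex.I * ξ) (by rw [hre]; linarith) φ
        rwa [hre, zero_add] at h
    obtain ⟨P, hP, hPlow, hPdec⟩ :=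
      exists_lyapunov_of_weak_observability (adjoint A) (adjoint B) hM0 hτ hγ hk hM hobs
    have hδ : 0 < τ / M ^ 2 := by positivity
    have hunit : IsUnit P := isUnit_of_forall_le_norm_inner_map P (c := ⟨τ / M ^ 2, hδ.le⟩) hδ
      fun φ => by
        rw [mul_comm, norm_inner_symm]
        exact (hPlow φ).trans (Complex.re_le_norm _)
    obtain ⟨Q, hQ⟩ := hunit.exists_left_inv
    have hQP (φ : H) : Q (P φ) = φ := DFunLike.congr_fun hQ φ
    let K : H →L[ℂ] U := (-(k * τ / 2)) • (adjoint B ∘L Q)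
    obtain ⟨M', hM', α, hα, hdecay⟩ := exp_decay_of_lyapunov (adjoint (A + B ∘L K)) P hP hδ
      (div_pos (sub_pos.2 hγ) (pow_pos hM0 2)) hPlow fun φ => by
        have hK : K (P φ) = (-(k * τ / 2)) • adjoint B φ := by
          change (-(k * τ / 2)) • adjoint B (Q (P φ)) = _
          rw [hQP]
        rw [hadj, inner_add_left, adjoint_inner_left K, hK, inner_smul_right_eq_smul,
          Complex.add_re, Complex.real_smul, Complex.re_ofReal_mul]
        have hsq : (inner ℂ (adjoint B φ) (adjoint B φ)).re = ‖adjoint B φ‖ ^ 2 :=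
          inner_self_eq_norm_sq (𝕜 := ℂ) _
        rw [hsq]
        have := hPdec φ
        linarith
    exact ⟨K, M', hM', α, hα, fun t ht =>
      (norm_exp_smul_adjoint _ t).symm.trans_le (hdecay t ht)⟩
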